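/- The shifted Hankel determinant of the Carlitz q-Euler numbers satisfies det_{0≤i,j≤n}(ε_{i+j+1}) = (−1)^{binom(n+2,2)} q^{(1/4)·binom(2n+4,3)} / ((1−q)^{n(n+1)} (1+q^2)^{n+1}) · Π_{k=1}^n (q^2;q^2)_k (q^4;q^2)_k / ((−q^2;q^2)_k (−q^3;q^2)_k (−q^3;q^2)_k (−q^4;q^2)_k). -/

import Mathlib

open Finset

noncomputable def q : RatFunc ℚ := RatFunc.X

/-- q-Pochhammer `(A;Q)_n`. -/
noncomputable def qPoch (Q A : RatFunc ℚ) (n : ℕ) : RatFunc ℚ :=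
  ∏ j ∈ Finset.range n, (1 - A * Q ^ j)

/-- The Cauchy matrix with entries `1 / (1 + x i * y j)`. -/
def cauchyMat {K : Type*} [Field K] (x y : ℕ → K) (n : ℕ) : Matrix (Fin n) (Fin n) K :=
  Matrix.of fun i j => 1 / (1 + x i * y j)

theorem one_div_one_add_mul_eq {K : Type*} [Field K] {a b c d : K} (hac : 1 + a * c ≠ 0)
    (had : 1 + a * d ≠ 0) (hbc : 1 + b * c ≠ 0) :
    1 / (1 + a * c) = (a - b) * (d - c) / ((1 + a * d) * (1 + b * c)) * (1 / (1 + a * c)) +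
      (1 + b * d) / (1 + a * d) * (1 / (1 + b * c)) := by
  rw [div_mul_div_comm, div_mul_div_comm, div_add_div _ _ (by positivity) (by positivity),
    div_eq_div_iff hac (by positivity)]
  ring

theorem det_cauchyMat_succ {K : Type*} [Field K] (x y : ℕ → K)
    (h : ∀ i j, 1 + x i * y j ≠ 0) (n : ℕ) :
    (cauchyMat x y (n + 1)).det = (cauchyMat x y n).det * (1 / (1 + x n * y n) *
      ∏ i ∈ range n, (x i - x n) * (y n - y i) / ((1 + x i * y n) * (1 + x n * y i))) := by
  have hreduce : (cauchyMat x y (n + 1)).det = (Matrix.of fun i j : Fin (n + 1) =>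
      if i = Fin.last n then 1 / (1 + x n * y j) else
      (x i - x n) * (y n - y j) /
        ((1 + x i * y n) * (1 + x n * y j)) * (1 / (1 + x i * y j))).det := by
    refine Matrix.det_eq_of_forall_row_eq_smul_add_const
      (fun i => if i = Fin.last n then 0 else (1 + x n * y n) / (1 + x i * y n))
      (Fin.last n) (by simp) ?_
    intro i j
    by_cases hi : i = Fin.last n
    · subst hi; simp [cauchyMat]
    · simp only [cauchyMat, Matrix.of_apply, hi, if_false, if_true]
      exact one_div_one_add_mul_eq (h i j) (h i n) (h n j)
  rw [hreduce, Matrix.det_succ_column _ (Fin.last n),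
    Finset.sum_eq_single (Fin.last n)]
  · have hsub : Matrix.submatrix (Matrix.of fun i j : Fin (n + 1) =>
        if i = Fin.last n then 1 / (1 + x n * y j) else
        (x i - x n) * (y n - y j) /
          ((1 + x i * y n) * (1 + x n * y j)) * (1 / (1 + x i * y j)))
        (Fin.last n).succAbove (Fin.last n).succAbove =
        Matrix.of fun i j : Fin n => ((x i - x n) / (1 + x i * y n)) *
          (Matrix.of fun i j : Fin n => ((y n - y j) / (1 + x n * y j)) *
            cauchyMat x y n i j) i j := by
      ext i j
      simp only [Matrix.submatrix_apply, Matrix.of_apply, Fin.succAbove_last, Fin.val_castSucc,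
        Fin.castSucc_ne_last, if_false, cauchyMat]
      rw [← mul_assoc, div_mul_div_comm _ _ (y n - y j)]
    rw [hsub, Matrix.det_mul_column, Matrix.det_mul_row]
    simp only [Matrix.of_apply, if_true, Fin.val_last, ← two_mul, pow_mul, neg_one_sq, one_pow]
    rw [Fin.prod_univ_eq_prod_range (fun i => (x i - x n) / (1 + x i * y n)) n,
      Fin.prod_univ_eq_prod_range (fun i => (y n - y i) / (1 + x n * y i)) n,
      ← mul_assoc (∏ i ∈ range n, _), ← Finset.prod_mul_distrib]
    simp only [div_mul_div_comm]
    ring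
  · intro i _ hi
    simp [hi]
  · simp

theorem one_add_q_pow_ne_zero (m : ℕ) : 1 + q ^ m ≠ 0 := by
  have h : (1 + Polynomial.X ^ m : Polynomial ℚ) ≠ 0 := fun h => by
    have := congrArg (Polynomial.eval 1) h
    norm_num at this
  have h2 := (RatFunc.algebraMap_ne_zero (K := ℚ) h)
  simpa [q] using h2

theorem one_sub_q_pow_succ_ne_zero (m : ℕ) : 1 - q ^ (m + 1) ≠ 0 := by
  have h : (1 - Polynomial.X ^ (m + 1) : Polynomial ℚ) ≠ 0 := fun h => by
    have := congrArg (Polynomial.eval 0) h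
    norm_num at this
  have h2 := (RatFunc.algebraMap_ne_zero (K := ℚ) h)
  simpa [q] using h2

/-- The linear functional on polynomials with moments `(1 + q) / (1 + q ^ (k + 1))`. -/
noncomputable def qEulerFunctional : Polynomial (RatFunc ℚ) →ₗ[RatFunc ℚ] RatFunc ℚ :=
  Polynomial.lsum fun k => ((1 + q) / (1 + q ^ (k + 1))) • LinearMap.id

theorem qEulerFunctional_X_pow (k : ℕ) :
    qEulerFunctional (Polynomial.X ^ k) = (1 + q) / (1 + q ^ (k + 1)) := by
  rw [← Polynomial.monomial_one_right_eq_X_pow]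
  simp [qEulerFunctional, Polynomial.lsum_apply, Polynomial.sum_monomial_index]

theorem qEulerFunctional_scale (p : Polynomial (RatFunc ℚ)) :
    q * qEulerFunctional (p.comp (Polynomial.C q * Polynomial.X)) + qEulerFunctional p =
      (1 + q) * p.eval 1 := by
  induction p using Polynomial.induction_on' with
  | add p r hp hr =>
    simp only [Polynomial.add_comp, map_add, Polynomial.eval_add]
    linear_combination hp + hr
  | monomial k a =>
    have h := one_add_q_pow_ne_zero (k + 1)
    have hcomp : (Polynomial.monomial k a).comp (Polynomial.C q * Polynomial.X) =
        (a * q ^ k) • Polynomial.X ^ k := by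
      rw [Polynomial.monomial_comp, mul_pow, ← mul_assoc, Polynomial.smul_eq_C_mul,
        Polynomial.C_mul, Polynomial.C_pow]
    rw [hcomp, ← Polynomial.C_mul_X_pow_eq_monomial, ← Polynomial.smul_eq_C_mul, map_smul,
      map_smul, qEulerFunctional_X_pow, Polynomial.eval_smul, Polynomial.eval_pow,
      Polynomial.eval_X, one_pow, smul_eq_mul, smul_eq_mul, smul_eq_mul]
    field_simp
    ring

open Polynomial in
theorem qEuler_eq_functional (ε : ℕ → RatFunc ℚ) (hε0 : ε 0 = 1)
    (hεrec : ∀ n : ℕ, 1 ≤ n →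
      (∑ k ∈ Finset.range (n + 1), (n.choose k : RatFunc ℚ) * q ^ (k + 1) * ε k) + ε n = 0)
    (n : ℕ) : ε n = qEulerFunctional ((C (1 / (1 - q)) * (1 - X)) ^ n) := by
  induction n using Nat.strong_induction_on with
  | _ n ih =>
  have hq := one_sub_q_pow_succ_ne_zero 0
  rw [zero_add, pow_one] at hq
  have hp := one_add_q_pow_ne_zero 1
  rw [pow_one] at hp
  rcases Nat.eq_zero_or_pos n with rfl | hn
  · have := qEulerFunctional_X_pow 0
    simp only [pow_zero, zero_add, pow_one] at this
    simp [hε0, this, hp]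
  · set u : Polynomial (RatFunc ℚ) := C (1 / (1 - q)) * (1 - X) with hu
    have hcomp : u.comp (C q * X) = C q * u + 1 := by
      have : (1 : Polynomial (RatFunc ℚ)) = C (1 / (1 - q)) * (1 - C q) := by
        rw [← C_1, ← C_sub, ← C_mul, one_div_mul_cancel hq]
      simp only [hu, mul_comp, C_comp, sub_comp, one_comp, X_comp]
      linear_combination -this
    have hs := qEulerFunctional_scale (u ^ n)
    have hev : (u ^ n).eval 1 = 0 := by simp [hu, hn.ne']
    rw [hev, mul_zero, pow_comp, hcomp, add_pow, map_sum, Finset.mul_sum] at hs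
    have hterm : ∀ k, q * qEulerFunctional
        ((C q * u) ^ k * 1 ^ (n - k) * (n.choose k : Polynomial (RatFunc ℚ))) =
        (n.choose k : RatFunc ℚ) * q ^ (k + 1) * qEulerFunctional (u ^ k) := by
      intro k
      have : (C q * u) ^ k * 1 ^ (n - k) * (n.choose k : Polynomial (RatFunc ℚ)) =
          (q ^ k * (n.choose k : RatFunc ℚ)) • u ^ k := by
        rw [smul_eq_C_mul, C_mul, C_pow, mul_pow, one_pow, C_eq_natCast]
        ring
      rw [this, map_smul, smul_eq_mul]
      ring
    simp only [hterm] at hs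
    have hr := hεrec n hn
    rw [Finset.sum_range_succ] at hs hr
    rw [Finset.sum_congr rfl fun k hk => by rw [ih k (Finset.mem_range.mp hk)]] at hr
    simp only [Nat.choose_self, Nat.cast_one, one_mul] at hs hr
    apply mul_left_cancel₀ (one_add_q_pow_ne_zero (n + 1))
    linear_combination hr - hs

theorem det_neg_one_pow_mul_choose_sq (n : ℕ) :
    (Matrix.of fun i k : Fin n =>
      ((-1) ^ (k : ℕ) * ((i : ℕ).choose k : RatFunc ℚ))).det ^ 2 = 1 := by
  rw [Matrix.det_of_isLowerTriangular]
  · simp [← Finset.prod_pow, ← pow_mul, mul_comm _ 2]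
  · intro i k hik
    have : (i : ℕ) < k := by simpa using hik
    simp [Nat.choose_eq_zero_of_lt this]

open Polynomial in
theorem one_sub_X_pow_eq_sum_fin {R : Type*} [CommRing R] {n : ℕ} (i : Fin n) :
    (1 - X : R[X]) ^ (i : ℕ) =
      ∑ k : Fin n, ((-1) ^ (k : ℕ) * ((i : ℕ).choose k : R)) • X ^ (k : ℕ) := by
  rw [Fin.sum_univ_eq_sum_range
    (fun k => ((-1) ^ k * ((i : ℕ).choose k : R)) • (X : R[X]) ^ k) n, sub_eq_neg_add, add_pow]
  refine Finset.sum_subset_zero_on_sdiff (by simp) ?_ ?_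
  · intro k hk
    have : (i : ℕ) < k := by simp at hk; omega
    simp [Nat.choose_eq_zero_of_lt this]
  · intro k _
    rw [smul_eq_C_mul, C_mul, C_pow, C_neg, C_1, C_eq_natCast, one_pow, neg_pow (X : R[X])]
    ring

open Polynomial in
theorem det_qEuler_eq_det_moments (ε : ℕ → RatFunc ℚ)
    (hε : ∀ n, ε n = qEulerFunctional ((C (1 / (1 - q)) * (1 - X)) ^ n)) (n : ℕ) :
    Matrix.det (Matrix.of fun i j : Fin (n + 1) => ε ((i : ℕ) + (j : ℕ) + 1)) =
      (1 / (1 - q)) ^ ((n + 1) ^ 2) *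
        Matrix.det (Matrix.of fun k l : Fin (n + 1) =>
          qEulerFunctional ((1 - X) * X ^ ((k : ℕ) + l))) := by
  set T := Matrix.of fun i k : Fin (n + 1) =>
      ((-1) ^ (k : ℕ) * ((i : ℕ).choose k : RatFunc ℚ)) with hT
  set N := Matrix.of fun k l : Fin (n + 1) =>
          qEulerFunctional ((1 - X) * X ^ ((k : ℕ) + l)) with hN
  have hmat : (Matrix.of fun i j : Fin (n + 1) => ε ((i : ℕ) + (j : ℕ) + 1)) =
      Matrix.of fun i j : Fin (n + 1) => (1 / (1 - q)) ^ (i : ℕ) *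
        (Matrix.of fun i j : Fin (n + 1) => (1 / (1 - q)) ^ ((j : ℕ) + 1) *
          (T * N * T.transpose) i j) i j := by
    ext i j
    have hfun : (T * N * T.transpose) i j =
        qEulerFunctional ((1 - X) * ((1 - X) ^ (i : ℕ) * (1 - X) ^ (j : ℕ))) := by
      rw [one_sub_X_pow_eq_sum_fin i, one_sub_X_pow_eq_sum_fin j, Finset.sum_mul_sum,
        Finset.mul_sum, map_sum, Matrix.mul_apply]
      simp only [Matrix.mul_apply, Matrix.transpose_apply, Finset.sum_mul]
      rw [Finset.sum_comm]
      refine Finset.sum_congr rfl fun k _ => ?_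
      rw [Finset.mul_sum, map_sum]
      refine Finset.sum_congr rfl fun l _ => ?_
      rw [smul_mul_smul_comm, ← pow_add, mul_smul_comm, map_smul, smul_eq_mul]
      simp only [hT, hN, Matrix.of_apply]
      ring
    simp only [Matrix.of_apply]
    rw [hfun, hε, mul_pow, ← C_pow, ← smul_eq_C_mul, map_smul, smul_eq_mul, ← mul_assoc,
      ← pow_add, add_assoc]
    congr 2
    ring
  rw [hmat, Matrix.det_mul_column, Matrix.det_mul_row, Matrix.det_mul, Matrix.det_mul,
    Matrix.det_transpose]
  have hdet : T.det ^ 2 = 1 := det_neg_one_pow_mul_choose_sq (n + 1)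
  have hprod : (∏ i : Fin (n + 1), (1 / (1 - q)) ^ (i : ℕ)) *
      ∏ i : Fin (n + 1), (1 / (1 - q)) ^ ((i : ℕ) + 1) = (1 / (1 - q)) ^ ((n + 1) ^ 2) := by
    rw [← Finset.prod_mul_distrib,
      Fin.prod_univ_eq_prod_range (fun i => (1 / (1 - q)) ^ i * (1 / (1 - q)) ^ (i + 1))]
    induction n + 1 with
    | zero => simp
    | succ m ih => rw [Finset.prod_range_succ, ih]; ring
  rw [← hprod]
  linear_combination (∏ i : Fin (n + 1), (1 / (1 - q)) ^ (i : ℕ)) *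
      (∏ i : Fin (n + 1), (1 / (1 - q)) ^ ((i : ℕ) + 1)) * N.det * hdet

/-- The nodes `0, q, q ^ 2, …`. -/
noncomputable def qNode : ℕ → RatFunc ℚ
  | 0 => 0
  | i + 1 => q ^ (i + 1)

theorem one_add_qNode_mul_ne_zero (i j : ℕ) : 1 + qNode i * q ^ j ≠ 0 := by
  cases i with
  | zero => simp [qNode]
  | succ i => rw [qNode, ← pow_add]; exact one_add_q_pow_ne_zero _

open Polynomial in
theorem det_moments_eq_det_cauchyMat (n : ℕ) :
    Matrix.det (Matrix.of fun k l : Fin n => qEulerFunctional ((1 - X) * X ^ ((k : ℕ) + l))) =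
      (-(1 + q)) ^ n * (cauchyMat qNode (q ^ ·) (n + 1)).det := by
  have hdiff : (cauchyMat qNode (q ^ ·) (n + 1)).det =
      (Matrix.of fun i j : Fin (n + 1) => Fin.cases (motive := fun _ => RatFunc ℚ)
        (cauchyMat qNode (q ^ ·) (n + 1) i 0) (fun j => cauchyMat qNode (q ^ ·) (n + 1) i j.succ -
          cauchyMat qNode (q ^ ·) (n + 1) i j.castSucc) j).det := by
    refine Matrix.det_eq_of_forall_col_eq_smul_add_pred (fun _ => 1) (by simp) ?_
    intro i j
    simp
  rw [hdiff, Matrix.det_succ_row_zero, Finset.sum_eq_single 0]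
  · have hsub : (Matrix.of fun k l : Fin n =>
        qEulerFunctional ((1 - X) * X ^ ((k : ℕ) + l))) = (-(1 + q)) •
        Matrix.submatrix (Matrix.of fun i j : Fin (n + 1) =>
          Fin.cases (motive := fun _ => RatFunc ℚ) (cauchyMat qNode (q ^ ·) (n + 1) i 0)
            (fun j => cauchyMat qNode (q ^ ·) (n + 1) i j.succ -
              cauchyMat qNode (q ^ ·) (n + 1) i j.castSucc) j) Fin.succ (Fin.succAbove 0) := by
      ext k l
      rw [Matrix.of_apply, sub_mul, one_mul, ← pow_succ', map_sub, qEulerFunctional_X_pow,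
        qEulerFunctional_X_pow]
      simp only [Matrix.smul_apply, Matrix.submatrix_apply, Fin.zero_succAbove, Matrix.of_apply,
        Fin.cases_succ, cauchyMat, Fin.val_succ, Fin.val_castSucc, qNode, ← pow_add, smul_eq_mul]
      rw [show (k : ℕ) + 1 + (l + 1) = k + l + 1 + 1 by ring,
        show (k : ℕ) + 1 + l = k + l + 1 by ring]
      ring
    rw [hsub, Matrix.det_smul]
    simp [cauchyMat, qNode]
  · intro j _ hj
    obtain ⟨j, rfl⟩ := Fin.exists_succ_eq.mpr hj
    simp [cauchyMat, qNode]
  · simp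

/-- The product of `1 + q ^ i` over `1 ≤ i ≤ m`. -/
noncomputable def prodAdd (m : ℕ) : RatFunc ℚ := ∏ i ∈ range m, (1 + q ^ (i + 1))

/-- The product of `1 - q ^ i` over `1 ≤ i ≤ m`. -/
noncomputable def prodSub (m : ℕ) : RatFunc ℚ := ∏ i ∈ range m, (1 - q ^ (i + 1))

theorem prodAdd_succ (m : ℕ) : prodAdd (m + 1) = prodAdd m * (1 + q ^ (m + 1)) :=
  Finset.prod_range_succ _ _

theorem prodSub_succ (m : ℕ) : prodSub (m + 1) = prodSub m * (1 - q ^ (m + 1)) :=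
  Finset.prod_range_succ _ _

theorem prodAdd_ne_zero (m : ℕ) : prodAdd m ≠ 0 :=
  Finset.prod_ne_zero_iff.mpr fun _ _ => one_add_q_pow_ne_zero _

theorem qPoch_succ (Q A : RatFunc ℚ) (k : ℕ) :
    qPoch Q A (k + 1) = qPoch Q A k * (1 - A * Q ^ k) := Finset.prod_range_succ _ _

theorem qPoch_q_sq (k : ℕ) : qPoch (q ^ 2) (q ^ 2) k = prodSub k * prodAdd k := by
  induction k with
  | zero => simp [qPoch, prodSub, prodAdd]
  | succ k ih => rw [qPoch_succ, ih, prodSub_succ, prodAdd_succ]; ring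

theorem qPoch_q_four (k : ℕ) :
    (1 - q) * (1 + q) * qPoch (q ^ 2) (q ^ 4) k = prodSub (k + 1) * prodAdd (k + 1) := by
  induction k with
  | zero => simp [qPoch, prodSub, prodAdd]
  | succ k ih =>
    rw [qPoch_succ, prodSub_succ, prodAdd_succ]
    linear_combination (1 - q ^ 4 * (q ^ 2) ^ k) * ih

theorem qPoch_neg_q_two_three (k : ℕ) :
    (1 + q) * (qPoch (q ^ 2) (-q ^ 2) k * qPoch (q ^ 2) (-q ^ 3) k) = prodAdd (2 * k + 1) := by
  induction k with
  | zero => simp [qPoch, prodAdd]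
  | succ k ih =>
    rw [qPoch_succ, qPoch_succ, show 2 * (k + 1) + 1 = 2 * k + 1 + 1 + 1 by ring, prodAdd_succ,
      prodAdd_succ, ← ih]
    ring

theorem qPoch_neg_q_three_four (k : ℕ) :
    (1 + q) * (1 + q ^ 2) * (qPoch (q ^ 2) (-q ^ 3) k * qPoch (q ^ 2) (-q ^ 4) k) =
      prodAdd (2 * k + 2) := by
  induction k with
  | zero => simp [qPoch, prodAdd, Finset.prod_range_succ]
  | succ k ih =>
    rw [qPoch_succ, qPoch_succ, show 2 * (k + 1) + 2 = 2 * k + 2 + 1 + 1 by ring, prodAdd_succ,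
      prodAdd_succ, ← ih]
    ring

theorem prod_qNode_num (m : ℕ) :
    ∏ i ∈ range (m + 1), (qNode i - qNode (m + 1)) * (q ^ (m + 1) - q ^ i) =
      (-1) ^ m * q ^ ((m + 1) ^ 2) * (prodSub (m + 1) * prodSub m) := by
  have hterm : ∀ i ∈ range m, (qNode (i + 1) - qNode (m + 1)) * (q ^ (m + 1) - q ^ (i + 1)) =
      -1 * q ^ (2 * (i + 1)) * ((1 - q ^ (m - 1 - i + 1)) * (1 - q ^ (m - 1 - i + 1))) := by
    intro i hi
    obtain ⟨d, rfl⟩ : ∃ d, m = i + 1 + d := Nat.exists_eq_add_of_le (Finset.mem_range.mp hi)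
    rw [show i + 1 + d - 1 - i = d by omega, qNode, qNode]
    ring
  have hpow : ∏ i ∈ range m, q ^ (2 * (i + 1)) = q ^ (m * (m + 1)) := by
    clear hterm
    induction m with
    | zero => simp
    | succ m ih => rw [Finset.prod_range_succ, ih]; ring
  rw [Finset.prod_range_succ', Finset.prod_congr rfl hterm, Finset.prod_mul_distrib,
    Finset.prod_mul_distrib, Finset.prod_mul_distrib, hpow,
    Finset.prod_range_reflect (fun i => 1 - q ^ (i + 1)) m, ← prodSub, Finset.prod_const,
    Finset.card_range, prodSub_succ, qNode, qNode]
  ring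

theorem prod_qNode_den (m : ℕ) :
    prodAdd (m + 1) ^ 2 *
        ∏ i ∈ range (m + 1), (1 + qNode i * q ^ (m + 1)) * (1 + qNode (m + 1) * q ^ i) =
      (1 + q ^ (m + 1)) * prodAdd (2 * m + 1) ^ 2 := by
  have hterm : ∀ i ∈ range m,
      (1 + qNode (i + 1) * q ^ (m + 1)) * (1 + qNode (m + 1) * q ^ (i + 1)) =
        (1 + q ^ (m + 1 + i + 1)) * (1 + q ^ (m + 1 + i + 1)) := by
    intro i _
    rw [qNode, qNode]
    ring
  have hsplit : prodAdd (2 * m + 1) =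
      prodAdd (m + 1) * ∏ i ∈ range m, (1 + q ^ (m + 1 + i + 1)) := by
    rw [show 2 * m + 1 = m + 1 + m by ring, prodAdd, Finset.prod_range_add, prodAdd]
  rw [Finset.prod_range_succ', Finset.prod_congr rfl hterm, Finset.prod_mul_distrib, hsplit,
    qNode, qNode]
  ring

theorem det_cauchyMat_qNode_succ (m : ℕ) :
    (1 + q) * (cauchyMat qNode (q ^ ·) (m + 2)).det =
      (cauchyMat qNode (q ^ ·) (m + 1)).det * ((-1) ^ m * q ^ ((m + 1) ^ 2) *
        ((1 - q) / (1 + q ^ 2)) * (qPoch (q ^ 2) (q ^ 2) m * qPoch (q ^ 2) (q ^ 4) m /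
              (qPoch (q ^ 2) (-q ^ 2) m * qPoch (q ^ 2) (-q ^ 3) m * qPoch (q ^ 2) (-q ^ 3) m *
                qPoch (q ^ 2) (-q ^ 4) m))) := by
  have h1 : 1 + q ≠ 0 := by simpa using one_add_q_pow_ne_zero 1
  have h2 := one_add_q_pow_ne_zero 2
  have hq : 1 - q ≠ 0 := by simpa using one_sub_q_pow_succ_ne_zero 0
  have hm := one_add_q_pow_ne_zero (m + 1)
  have h2m := one_add_q_pow_ne_zero (2 * m + 2)
  have hA := prodAdd_ne_zero m
  have hA' := prodAdd_ne_zero (2 * m + 1)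
  have e4 := qPoch_q_four m
  have e23 := qPoch_neg_q_two_three m
  have e34 := qPoch_neg_q_three_four m
  have hden := prod_qNode_den m
  rw [prodAdd_succ] at e4 hden
  rw [prodAdd_succ (2 * m + 1)] at e34
  rw [det_cauchyMat_succ _ _ one_add_qNode_mul_ne_zero, Finset.prod_div_distrib, prod_qNode_num,
    qPoch_q_sq, show qNode (m + 1) * q ^ (m + 1) = q ^ (2 * m + 2) by rw [qNode]; ring]
  rw [mul_assoc (_ * _) (qPoch (q ^ 2) (-q ^ 3) m)]
  generalize (∏ i ∈ range (m + 1),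
      (1 + qNode i * q ^ (m + 1)) * (1 + qNode (m + 1) * q ^ i)) = D at *
  generalize qPoch (q ^ 2) (-q ^ 2) m * qPoch (q ^ 2) (-q ^ 3) m = U at *
  generalize qPoch (q ^ 2) (-q ^ 3) m * qPoch (q ^ 2) (-q ^ 4) m = V at *
  have hY : qPoch (q ^ 2) (q ^ 4) m =
      prodSub (m + 1) * (prodAdd m * (1 + q ^ (m + 1))) / ((1 - q) * (1 + q)) :=
    eq_div_of_mul_eq (mul_ne_zero hq h1) (by rw [← e4]; ring)
  have hU : U = prodAdd (2 * m + 1) / (1 + q) := eq_div_of_mul_eq h1 (by rw [← e23]; ring)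
  have hV : V = prodAdd (2 * m + 1) * (1 + q ^ (2 * m + 2)) / ((1 + q) * (1 + q ^ 2)) :=
    eq_div_of_mul_eq (mul_ne_zero h1 h2) (by rw [← e34]; ring)
  have hD : D = (1 + q ^ (m + 1)) * prodAdd (2 * m + 1) ^ 2 /
      (prodAdd m * (1 + q ^ (m + 1))) ^ 2 :=
    eq_div_of_mul_eq (pow_ne_zero 2 (mul_ne_zero hA hm)) (by rw [← hden]; ring)
  rw [hY, hU, hV, hD]
  generalize 1 + q ^ (2 * m + 2) = E at *
  generalize 1 + q ^ (m + 1) = e at *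
  generalize 1 + q ^ 2 = c at *
  generalize 1 + q = a at *
  generalize 1 - q = b at *
  field_simp

theorem choose_three_add_two (n : ℕ) :
    (2 * (n + 1) + 4).choose 3 = (2 * n + 4).choose 3 + 4 * (n + 2) ^ 2 := by
  have h2 : (2 * n + 4).choose 2 = (n + 2) * (2 * n + 3) := by
    rw [Nat.choose_two_right, show (2 * n + 4) * (2 * n + 4 - 1) =
      2 * ((n + 2) * (2 * n + 3)) by rw [show 2 * n + 4 - 1 = 2 * n + 3 by omega]; ring]
    simp
  rw [show 2 * (n + 1) + 4 = 2 * n + 4 + 1 + 1 by ring, Nat.choose_succ_succ' _ 2,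
    Nat.choose_succ_succ' _ 1, Nat.choose_succ_succ' _ 2, h2, Nat.choose_one_right]
  ring

theorem hankel_qEuler_shift_one (ε : ℕ → RatFunc ℚ) (hε0 : ε 0 = 1)
    (hεrec : ∀ n : ℕ, 1 ≤ n →
      (∑ k ∈ Finset.range (n + 1), (n.choose k : RatFunc ℚ) * q ^ (k + 1) * ε k) + ε n = 0) :
    ∀ n : ℕ,
      Matrix.det (Matrix.of fun i j : Fin (n + 1) => ε ((i : ℕ) + (j : ℕ) + 1)) =
        (-1) ^ ((n + 2).choose 2) * q ^ ((2 * n + 4).choose 3 / 4) /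
            ((1 - q) ^ (n * (n + 1)) * (1 + q ^ 2) ^ (n + 1)) *
          ∏ k ∈ Finset.Icc 1 n,
            qPoch (q ^ 2) (q ^ 2) k * qPoch (q ^ 2) (q ^ 4) k /
              (qPoch (q ^ 2) (-q ^ 2) k * qPoch (q ^ 2) (-q ^ 3) k * qPoch (q ^ 2) (-q ^ 3) k *
                qPoch (q ^ 2) (-q ^ 4) k) := by
  intro n
  rw [det_qEuler_eq_det_moments ε (qEuler_eq_functional ε hε0 hεrec),
    det_moments_eq_det_cauchyMat]
  have hq : 1 - q ≠ 0 := by simpa using one_sub_q_pow_succ_ne_zero 0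
  have h2 := one_add_q_pow_ne_zero 2
  induction n with
  | zero =>
    have h0 := det_cauchyMat_qNode_succ 0
    have h1 : (cauchyMat qNode (q ^ ·) 1).det = 1 := by simp [cauchyMat, qNode]
    simp only [zero_add, h1, qPoch, Finset.prod_range_zero] at h0
    simp
    field_simp at h0 ⊢
    linear_combination -h0
  | succ n ih =>
    have hr := det_cauchyMat_qNode_succ (n + 1)
    rw [Finset.prod_Icc_succ_top (by omega)]
    have hexp : (2 * (n + 1) + 4).choose 3 / 4 = (2 * n + 4).choose 3 / 4 + (n + 2) ^ 2 := by
      rw [choose_three_add_two n, Nat.add_mul_div_left _ _ (by norm_num)]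
    have hsgn : (n + 1 + 2).choose 2 = (n + 2).choose 2 + (n + 2) := by
      rw [show n + 1 + 2 = (n + 2) + 1 by ring, Nat.choose_succ_succ' (n + 2) 1,
        Nat.choose_one_right, add_comm]
    generalize qPoch (q ^ 2) (q ^ 2) (n + 1) * qPoch (q ^ 2) (q ^ 4) (n + 1) /
      (qPoch (q ^ 2) (-q ^ 2) (n + 1) * qPoch (q ^ 2) (-q ^ 3) (n + 1) *
        qPoch (q ^ 2) (-q ^ 3) (n + 1) * qPoch (q ^ 2) (-q ^ 4) (n + 1)) = W at *
    calc (1 / (1 - q)) ^ (n + 1 + 1) ^ 2 *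
          ((-(1 + q)) ^ (n + 1 + 1) * (cauchyMat qNode (q ^ ·) (n + 1 + 1 + 1)).det)
        = (1 / (1 - q)) ^ (2 * n + 3) * (-1) * (1 / (1 - q)) ^ (n + 1) ^ 2 * (-(1 + q)) ^ (n + 1) *
          ((1 + q) * (cauchyMat qNode (q ^ ·) (n + 1 + 2)).det) := by ring
      _ = (1 / (1 - q)) ^ (2 * n + 3) * (-1) * ((-1) ^ (n + 1) * q ^ ((n + 1 + 1) ^ 2) *
          ((1 - q) / (1 + q ^ 2)) * W) * ((1 / (1 - q)) ^ (n + 1) ^ 2 *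
            ((-(1 + q)) ^ (n + 1) * (cauchyMat qNode (q ^ ·) (n + 1 + 1)).det)) := by
        rw [hr]; ring
      _ = _ := by
        rw [ih, hexp, hsgn]
        generalize (∏ k ∈ Icc 1 n, _ : RatFunc ℚ) = Z
        generalize 1 + q ^ 2 = c at *
        generalize 1 - q = b at *
        rw [one_div, inv_pow]
        field_simp
        ring
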